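/- Fix ε = 1 or ε = −1. Inside sp(3,ℝ) = {[[A,B],[C,−Aᵀ]] : B = Bᵀ, C = Cᵀ, A,B,C ∈ M₃(ℝ)}, with the general element parametrized by the entries a₁₁,a₁₂,a₂₂ (of the symmetric 2×2 block a of C), u₁,u₂, p₁,p₂, p, c₁₁,c₁₂,c₂₁,c₂₂, c, q₁,q₂, q, v₁,v₂, and b₁₁,b₁₂,b₂₂ (of the symmetric 2×2 block b of B), let t_ε be the set of elements satisfying the linear relations: b₁₁ = (32/9)a₁₁, b₁₂ = 0, b₂₂ = 0, c₁₁ = −(2/3)ε a₁₁, c₂₁ = 0, c₂₂ = −c − ε a₁₁, q₁ = (ε/3)(3p₁ + u₁), q₂ = 0, q = 3c, p = c, v₁ = ε(3u₁ − (5/3)p₁), v₂ = 0. Then t_ε is a 9-dimensional linear subspace of sp(3,ℝ) which is closed under the matrix commutator, i.e. t_ε is a Lie subalgebra of sp(3,ℝ). -/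

import Mathlib

open Matrix

noncomputable section

/-- Assemble a 6×6 matrix from four 3×3 blocks. -/
def blk6 (A B C D : Matrix (Fin 3) (Fin 3) ℝ) : Matrix (Fin 6) (Fin 6) ℝ :=
  Matrix.reindex finSumFinEquiv finSumFinEquiv (Matrix.fromBlocks A B C D)

/-- The standard symplectic matrix `J = [[0, I₃], [−I₃, 0]]`. -/
def J6 : Matrix (Fin 6) (Fin 6) ℝ := blk6 0 1 (-1) 0

/-- The general element of `sp(3,ℝ)`: `X = [[A,B],[C,−Aᵀ]]` with
`A = [[c₁₁,c₁₂,q₁],[c₂₁,c₂₂,q₂],[−p₁,−p₂,c]]`,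
`B = [[b₁₁,b₁₂,v₁],[b₁₂,b₂₂,v₂],[v₁,v₂,q]]`, `C = [[a₁₁,a₁₂,u₁],[a₁₂,a₂₂,u₂],[u₁,u₂,p]]`. -/
def spElt (a11 a12 a22 u1 u2 p1 p2 p c11 c12 c21 c22 c q1 q2 q v1 v2 b11 b12 b22 : ℝ) :
    Matrix (Fin 6) (Fin 6) ℝ :=
  blk6 !![c11, c12, q1; c21, c22, q2; -p1, -p2, c]
       !![b11, b12, v1; b12, b22, v2; v1, v2, q]
       !![a11, a12, u1; a12, a22, u2; u1, u2, p]
       (-(!![c11, c12, q1; c21, c22, q2; -p1, -p2, c]ᵀ))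

/-- The set `t_ε ⊂ sp(3,ℝ)` cut out by the linear relations
`b₁₁ = (32/9)a₁₁`, `b₁₂ = b₂₂ = 0`, `c₁₁ = −(2/3)ε a₁₁`, `c₂₁ = 0`, `c₂₂ = −c − ε a₁₁`,
`q₁ = (ε/3)(3p₁ + u₁)`, `q₂ = 0`, `q = 3c`, `p = c`, `v₁ = ε(3u₁ − (5/3)p₁)`, `v₂ = 0`. -/
def tEps (ε : ℝ) : Set (Matrix (Fin 6) (Fin 6) ℝ) :=
  {X | ∃ a11 a12 a22 u1 u2 p1 p2 c12 c : ℝ,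
    X = spElt a11 a12 a22 u1 u2 p1 p2 c
      (-(2/3) * ε * a11) c12 0 (-c - ε * a11) c
      ((ε/3) * (3 * p1 + u1)) 0 (3 * c)
      (ε * (3 * u1 - (5/3) * p1)) 0
      ((32/9) * a11) 0 0}

/-- Explicit form of the assembled matrix. -/
theorem spElt_explicit
    (a11 a12 a22 u1 u2 p1 p2 p c11 c12 c21 c22 c q1 q2 q v1 v2 b11 b12 b22 : ℝ) :
    spElt a11 a12 a22 u1 u2 p1 p2 p c11 c12 c21 c22 c q1 q2 q v1 v2 b11 b12 b22 =
      !![c11, c12, q1, b11, b12, v1;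
         c21, c22, q2, b12, b22, v2;
         -p1, -p2, c, v1, v2, q;
         a11, a12, u1, -c11, -c21, p1;
         a12, a22, u2, -c12, -c22, p2;
         u1, u2, p, -q1, -q2, -c] := by
  have h : spElt a11 a12 a22 u1 u2 p1 p2 p c11 c12 c21 c22 c q1 q2 q v1 v2 b11 b12 b22 =
      !![c11, c12, q1, b11, b12, v1;
         c21, c22, q2, b12, b22, v2;
         -p1, -p2, c, v1, v2, q;
         a11, a12, u1, -c11, -c21, - -p1;
         a12, a22, u2, -c12, -c22, - -p2;
         u1, u2, p, -q1, -q2, -c] := by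
    ext i j
    fin_cases i <;> fin_cases j <;> rfl
  rw [h, neg_neg, neg_neg]

theorem J6_explicit :
    J6 = !![0, 0, 0, 1, 0, 0;
            0, 0, 0, 0, 1, 0;
            0, 0, 0, 0, 0, 1;
            -1, 0, 0, 0, 0, 0;
            0, -1, 0, 0, 0, 0;
            0, 0, -1, 0, 0, 0] := by
  ext i j
  fin_cases i <;> fin_cases j <;> simp [J6, blk6, finSumFinEquiv, Fin.addCases]

/-- The parametrization of `t_ε` by nine real parameters. -/
def tMat (ε : ℝ) (x : Fin 9 → ℝ) : Matrix (Fin 6) (Fin 6) ℝ :=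
  !![-(2/3) * ε * x 0, x 7, (ε/3) * (3 * x 5 + x 3), (32/9) * x 0, 0, ε * (3 * x 3 - (5/3) * x 5);
     0, -x 8 - ε * x 0, 0, 0, 0, 0;
     -x 5, -x 6, x 8, ε * (3 * x 3 - (5/3) * x 5), 0, 3 * x 8;
     x 0, x 1, x 3, -(-(2/3) * ε * x 0), -0, x 5;
     x 1, x 2, x 4, -x 7, -(-x 8 - ε * x 0), x 6;
     x 3, x 4, x 8, -((ε/3) * (3 * x 5 + x 3)), -0, -x 8]

/-- The parametrization as a linear map. -/
def tLin (ε : ℝ) : (Fin 9 → ℝ) →ₗ[ℝ] Matrix (Fin 6) (Fin 6) ℝ where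
  toFun := tMat ε
  map_add' x y := by
    ext i j
    fin_cases i <;> fin_cases j <;> simp [tMat] <;> ring
  map_smul' r x := by
    ext i j
    fin_cases i <;> fin_cases j <;> simp [tMat] <;> ring

theorem tLin_injective (ε : ℝ) : Function.Injective (tLin ε) := by
  intro x y h
  have e : ∀ i j, tMat ε x i j = tMat ε y i j := fun i j => congrFun (congrFun h i) j
  funext k
  fin_cases k
  · exact e 3 0
  · exact e 3 1
  · exact e 4 1
  · exact e 3 2
  · exact e 4 2
  · exact e 3 5
  · exact e 4 5
  · exact e 0 1
  · exact e 2 2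

set_option maxHeartbeats 4000000 in
theorem tMat_comm (ε : ℝ) (hε : ε = 1 ∨ ε = -1) (x y : Fin 9 → ℝ) :
    ∃ z, tMat ε z = tMat ε x * tMat ε y - tMat ε y * tMat ε x := by
  obtain ⟨Z, hZ⟩ : ∃ Z, Z = tMat ε x * tMat ε y - tMat ε y * tMat ε x := ⟨_, rfl⟩
  refine ⟨![Z 3 0, Z 3 1, Z 4 1, Z 3 2, Z 4 2, Z 3 5, Z 4 5, Z 0 1, Z 2 2], ?_⟩
  rw [← hZ]
  have e : ∀ i j, Z i j =
      ∑ k, tMat ε x i k * tMat ε y k j - ∑ k, tMat ε y i k * tMat ε x k j := by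
    intro i j
    rw [hZ, Matrix.sub_apply, Matrix.mul_apply, Matrix.mul_apply]
  clear hZ
  ext i j
  fin_cases i <;> fin_cases j <;> simp [tMat] <;> simp only [e, Fin.sum_univ_six] <;>
    simp [tMat] <;> rcases hε with rfl | rfl <;> ring

/-- For `ε = ±1`, `t_ε` is a 9-dimensional linear subspace of `sp(3,ℝ)` closed under the
matrix commutator, i.e. a Lie subalgebra of `sp(3,ℝ)`. -/
theorem tEps_lie_subalgebra (ε : ℝ) (hε : ε = 1 ∨ ε = -1) :
    ∃ T : Submodule ℝ (Matrix (Fin 6) (Fin 6) ℝ),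
      (T : Set (Matrix (Fin 6) (Fin 6) ℝ)) = tEps ε ∧
      (∀ X ∈ T, Xᵀ * J6 + J6 * X = 0) ∧
      Module.finrank ℝ T = 9 ∧
      (∀ X ∈ T, ∀ Y ∈ T, X * Y - Y * X ∈ T) := by
  refine ⟨LinearMap.range (tLin ε), ?_, ?_, ?_, ?_⟩
  · ext X
    constructor
    · rintro ⟨x, rfl⟩
      exact ⟨x 0, x 1, x 2, x 3, x 4, x 5, x 6, x 7, x 8, (spElt_explicit ..).symm⟩
    · rintro ⟨a11, a12, a22, u1, u2, p1, p2, c12, c, rfl⟩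
      exact ⟨![a11, a12, a22, u1, u2, p1, p2, c12, c], (spElt_explicit ..).symm⟩
  · rintro _ ⟨x, rfl⟩
    change (tMat ε x)ᵀ * J6 + J6 * tMat ε x = 0
    rw [J6_explicit]
    ext i j
    fin_cases i <;> fin_cases j <;>
      simp [tMat, Matrix.mul_apply, Fin.sum_univ_succ] <;> ring
  · rw [LinearMap.finrank_range_of_inj (tLin_injective ε)]
    simp
  · rintro _ ⟨x, rfl⟩ _ ⟨y, rfl⟩
    exact tMat_comm ε hε x y
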